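/- arXiv:1102.0040 — 5 statements merged into one kernel-verified Lean document; each statement's English description precedes it below -/
import Mathlib

section
/- For any binary string w of length m and any n ≥ m, the number of binary strings of length n that contain w as a subsequence equals ∑_{j=0}^{n-m} C(n,j); in particular, this count is the same for every string w of length m. -/
theorem card_split (n : ℕ) (P : List Bool → Prop) (a : Bool) :
    Nat.card {x : Fin (n + 1) → Bool // P (List.ofFn x)} =
      Nat.card {x : Fin n → Bool // P (a :: List.ofFn x)} +
      Nat.card {x : Fin n → Bool // P ((!a) :: List.ofFn x)} := by
  rw [← Nat.card_sum]
  symm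
  refine Nat.card_congr (Equiv.ofBijective (Sum.elim
    (fun x => ⟨Fin.cons a x.1, by simpa [List.ofFn_succ] using x.2⟩)
    (fun x => ⟨Fin.cons (!a) x.1, by simpa [List.ofFn_succ] using x.2⟩)) ⟨?_, ?_⟩)
  · rintro (⟨x, hx⟩ | ⟨x, hx⟩) (⟨y, hy⟩ | ⟨y, hy⟩) hxy <;>
      simpa [Fin.cons_inj] using hxy
  · rintro ⟨x, hx⟩
    have hx' := hx
    rw [List.ofFn_succ] at hx'
    by_cases h0 : x 0 = a
    · refine ⟨Sum.inl ⟨Fin.tail x, by rw [h0] at hx'; exact hx'⟩, ?_⟩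
      subst h0
      simp
    · have h1 : x 0 = !a := by
        revert h0; cases x 0 <;> cases a <;> simp
      refine ⟨Sum.inr ⟨Fin.tail x, by rw [h1] at hx'; exact hx'⟩, ?_⟩
      simp [← h1]

theorem sum_rec (n k : ℕ) :
    ∑ j ∈ Finset.range (k + 1), (n + 1).choose j =
      ∑ j ∈ Finset.range (k + 1), n.choose j + ∑ j ∈ Finset.range k, n.choose j := by
  induction k with
  | zero => simp
  | succ k ih =>
    rw [Finset.sum_range_succ, ih, Finset.sum_range_succ _ (k + 1),
      Finset.sum_range_succ _ k, Nat.choose_succ_succ]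
    ring

theorem card_aux (n : ℕ) : ∀ w : List Bool,
    Nat.card {x : Fin n → Bool // w.Sublist (List.ofFn x)} =
      ∑ j ∈ Finset.range (n + 1 - w.length), n.choose j := by
  induction n with
  | zero =>
    intro w
    cases w with
    | nil => simp
    | cons a w => simp
  | succ n ih =>
    intro w
    cases w with
    | nil => simp [Nat.sum_range_choose]
    | cons a w =>
      rw [card_split n (fun l => (a :: w).Sublist l) a]
      have h2 : ∀ x : Fin n → Bool, (a :: w).Sublist ((!a) :: List.ofFn x) ↔
          (a :: w).Sublist (List.ofFn x) := by
        intro x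
        rw [List.sublist_cons_iff]
        simp
      simp only [List.cons_sublist_cons, h2]
      rw [ih, ih]
      simp only [List.length_cons]
      rcases Nat.lt_or_ge n w.length with h | h
      · have e1 : n + 1 - w.length = 0 := by omega
        have e2 : n + 1 - (w.length + 1) = 0 := by omega
        have e3 : n + 1 + 1 - (w.length + 1) = 0 := by omega
        rw [e1, e2, e3]; simp
      · obtain ⟨k, rfl⟩ := Nat.exists_eq_add_of_le h
        have e1 : w.length + k + 1 - w.length = k + 1 := by omega
        have e2 : w.length + k + 1 - (w.length + 1) = k := by omega
        have e3 : w.length + k + 1 + 1 - (w.length + 1) = k + 1 := by omega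
        rw [e1, e2, e3, sum_rec]

/-- For any binary string w of length m and any n ≥ m, the number of
binary strings of length n that contain w as a subsequence equals
∑_{j=0}^{n-m} C(n,j). -/
theorem stmt_1 (n : ℕ) (w : List Bool) (h : w.length ≤ n) :
    Nat.card {x : Fin n → Bool // w.Sublist (List.ofFn x)} =
      ∑ j ∈ Finset.range (n - w.length + 1), n.choose j := by
  rw [card_aux, Nat.sub_add_comm h]
end

section
/- Let S and R be finite sets, let N : S → Finset R be an adjacency map, and let S' ⊆ S. Suppose every s ∈ S' satisfies |N(s)| ≤ D and every r ∈ R is adjacent to at most y elements of S' (i.e., |{s ∈ S' : r ∈ N(s)}| ≤ y), where y, D ≥ 1. Then there exists a subset C ⊆ S' with |C| ≥ |S'|/(y·D) such that the neighborhoods N(s) for s ∈ C are pairwise disjoint (equivalently, no r ∈ R is adjacent to two distinct elements of C). -/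
theorem stmt_3_aux {S R : Type*} [DecidableEq S] [DecidableEq R]
    (N : S → Finset R) (D y : ℕ) (hD : 1 ≤ D) (hy : 1 ≤ y) (S' : Finset S)
    (hdeg : ∀ s ∈ S', (N s).card ≤ D)
    (hback : ∀ r : R, (S'.filter fun s => r ∈ N s).card ≤ y) :
    ∃ C ⊆ S', S'.card ≤ C.card * (y * D) ∧
      ∀ s ∈ C, ∀ t ∈ C, s ≠ t → Disjoint (N s) (N t) := by
  induction S' using Finset.strongInduction with
  | H T ih =>
    rcases T.eq_empty_or_nonempty with rfl | ⟨s, hs⟩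
    · exact ⟨∅, by simp, by simp, by simp⟩
    set B : Finset S := {s} ∪ (N s).biUnion (fun r => T.filter fun t => r ∈ N t) with hB
    have hBcard : B.card ≤ y * D := by
      rcases (N s).eq_empty_or_nonempty with he | ⟨r, hr⟩
      · have h1 : B = {s} := by simp [hB, he]
        rw [h1, Finset.card_singleton]
        exact Nat.mul_pos hy hD
      · have h1 : B = (N s).biUnion (fun r => T.filter fun t => r ∈ N t) := by
          rw [hB, Finset.union_eq_right, Finset.singleton_subset_iff, Finset.mem_biUnion]
          exact ⟨r, hr, by simp [hs, hr]⟩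
        rw [h1]
        calc _ ≤ (N s).card * y := Finset.card_biUnion_le_card_mul _ _ _ fun r _ => hback r
          _ ≤ D * y := Nat.mul_le_mul_right _ (hdeg s hs)
          _ = y * D := Nat.mul_comm _ _
    have hsB : s ∈ B := by simp [hB]
    have hss : T \ B ⊂ T := by
      refine ⟨Finset.sdiff_subset, fun h => ?_⟩
      exact (Finset.mem_sdiff.1 (h hs)).2 hsB
    obtain ⟨C, hC, hcard, hdis⟩ := ih (T \ B) hss
      (fun t ht => hdeg t (hss.1 ht))
      (fun r => (Finset.card_le_card (Finset.filter_subset_filter _ hss.1)).trans (hback r))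
    have hsC : s ∉ C := fun h => (Finset.mem_sdiff.1 (hC h)).2 hsB
    have key : ∀ t ∈ C, Disjoint (N s) (N t) := by
      intro t ht
      have h := Finset.mem_sdiff.1 (hC ht)
      rw [Finset.disjoint_left]
      intro r hr hrt
      apply h.2
      rw [hB, Finset.mem_union, Finset.mem_biUnion]
      exact Or.inr ⟨r, hr, by simp [h.1, hrt]⟩
    refine ⟨insert s C, ?_, ?_, ?_⟩
    · exact Finset.insert_subset hs (hC.trans hss.1)
    · rw [Finset.card_insert_of_notMem hsC, Nat.add_mul, Nat.one_mul]
      have := Finset.card_le_card_sdiff_add_card (s := T) (t := B)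
      omega
    · intro a ha b hb hab
      rcases Finset.mem_insert.1 ha with rfl | ha2
      · rcases Finset.mem_insert.1 hb with rfl | hb2
        · exact absurd rfl hab
        · exact key b hb2
      · rcases Finset.mem_insert.1 hb with rfl | hb2
        · exact (key a ha2).symm
        · exact hdis a ha2 b hb2 hab

/-- Greedy codebook-selection lemma. If every s ∈ S' has at most D
neighbors in R and every r ∈ R is adjacent to at most y elements of S', with
y, D ≥ 1, then there is C ⊆ S' with |C| ≥ |S'|/(y·D) whose neighborhoods are
pairwise disjoint. -/
theorem stmt_3 {S R : Type*} [DecidableEq S] [DecidableEq R]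
    (N : S → Finset R) (S' : Finset S) (D y : ℕ) (hD : 1 ≤ D) (hy : 1 ≤ y)
    (hdeg : ∀ s ∈ S', (N s).card ≤ D)
    (hback : ∀ r : R, (S'.filter fun s => r ∈ N s).card ≤ y) :
    ∃ C ⊆ S', (S'.card : ℝ) / (y * D) ≤ (C.card : ℝ) ∧
      ∀ s ∈ C, ∀ t ∈ C, s ≠ t → Disjoint (N s) (N t) := by
  obtain ⟨C, hC, hcard, hdis⟩ := stmt_3_aux N D y hD hy S' hdeg hback
  refine ⟨C, hC, ?_, hdis⟩
  have hpos : (0 : ℝ) < y * D := by exact_mod_cast Nat.mul_pos hy hD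
  rw [div_le_iff₀ hpos]
  exact_mod_cast hcard
end

section
/- Let p ∈ (0, 1/2) be such that 1 - 2H(p) + p > 0, where H is the binary entropy function. Then there exist a constant c > 0 and an integer N such that for all n ≥ N there is a set C of binary strings of length n with |C| ≥ 2^{c·n} and with the property that no two distinct strings of C have a common subsequence of length at least n - ⌊p·n⌋. (Hence the zero-error capacity of the channel that adversarially deletes up to ⌊p·n⌋ of n transmitted bits is positive whenever 1 - 2H(p) + p > 0.) -/
/-- The binary entropy function H(p) = -p·log₂ p - (1-p)·log₂(1-p). -/
noncomputable def binEntropy (p : ℝ) : ℝ :=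
  -p * Real.logb 2 p - (1 - p) * Real.logb 2 (1 - p)

/-- Indicator that `l` is a subsequence of the string `x`. -/
noncomputable def subInd (l : List Bool) {n : ℕ} (x : Fin n → Bool) : ℝ :=
  open Classical in if l.Sublist (List.ofFn x) then 1 else 0

/-- Number of supersequences of `l` of length `n`. -/
noncomputable def superCount (n : ℕ) (l : List Bool) : ℝ :=
  ∑ x : Fin n → Bool, subInd l x

lemma subInd_nonneg (l : List Bool) {n : ℕ} (x : Fin n → Bool) : 0 ≤ subInd l x := by
  unfold subInd; split_ifs <;> norm_num

lemma superCount_nonneg (n : ℕ) (l : List Bool) : 0 ≤ superCount n l :=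
  Finset.sum_nonneg fun x _ => subInd_nonneg l x

lemma superCount_nil (n : ℕ) : superCount n [] = 2 ^ n := by
  simp [superCount, subInd]

lemma superCount_big (n : ℕ) (l : List Bool) (h : n < l.length) : superCount n l = 0 := by
  unfold superCount
  apply Finset.sum_eq_zero
  intro x _
  unfold subInd
  rw [if_neg]
  intro hs
  have := hs.length_le
  simp at this
  omega

lemma superCount_cons (n : ℕ) (a : Bool) (l : List Bool) :
    superCount (n + 1) (a :: l) = superCount n l + superCount n (a :: l) := by
  unfold superCount
  rw [← (Fin.consEquiv (fun _ : Fin (n + 1) => Bool)).sum_comp, Fintype.sum_prod_type,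
    Fintype.sum_bool]
  have h1 : ∀ x : Fin n → Bool,
      subInd (a :: l) (Fin.cons a x : Fin (n + 1) → Bool) = subInd l x := by
    intro x
    unfold subInd
    rw [List.ofFn_cons]
    simp
  have h2 : ∀ (b : Bool) (x : Fin n → Bool), b ≠ a →
      subInd (a :: l) (Fin.cons b x : Fin (n + 1) → Bool) = subInd (a :: l) x := by
    intro b x hb
    unfold subInd
    rw [List.ofFn_cons]
    congr 1
    apply propext
    constructor
    · intro hs
      cases hs with
      | cons _ h => exact h
      | cons_cons _ h => exact absurd rfl hb
    · intro hs
      exact hs.cons b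
  cases a
  · rw [add_comm]
    congr 1
    · exact Finset.sum_congr rfl fun x _ => h1 x
    · exact Finset.sum_congr rfl fun x _ => h2 true x (by simp)
  · congr 1
    · exact Finset.sum_congr rfl fun x _ => h1 x
    · exact Finset.sum_congr rfl fun x _ => h2 false x (by simp)

lemma superCount_le (q : ℝ) (hq0 : 0 < q) (hq1 : q < 1 / 2) (n : ℕ) :
    ∀ l : List Bool, superCount n l * (q ^ (n - l.length) * (1 - q) ^ l.length) ≤ 1 := by
  induction n with
  | zero =>
    intro l
    cases l with
    | nil => simp [superCount_nil]
    | cons a l => rw [superCount_big _ _ (by simp)]; simp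
  | succ n ih =>
    intro l
    cases l with
    | nil =>
      rw [superCount_nil]
      simp only [List.length_nil, Nat.sub_zero, pow_zero, mul_one]
      rw [← mul_pow]
      exact pow_le_one₀ (by linarith) (by linarith)
    | cons a l =>
      rw [superCount_cons]
      have h1 := ih l
      have h2 := ih (a :: l)
      simp only [List.length_cons] at h2 ⊢
      rw [Nat.add_sub_add_right]
      have e1 : superCount n l * (q ^ (n - l.length) * (1 - q) ^ (l.length + 1))
          = (1 - q) * (superCount n l * (q ^ (n - l.length) * (1 - q) ^ l.length)) := by ring
      have e2 : superCount n (a :: l) * (q ^ (n - l.length) * (1 - q) ^ (l.length + 1))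
          = q * (superCount n (a :: l) *
              (q ^ (n - (l.length + 1)) * (1 - q) ^ (l.length + 1))) := by
        by_cases hl : l.length + 1 ≤ n
        · have : n - l.length = (n - (l.length + 1)) + 1 := by omega
          rw [this]; ring
        · rw [superCount_big n (a :: l) (by simp; omega)]; simp
      rw [add_mul, e1, e2]
      nlinarith

lemma entropy_bound (p : ℝ) (hp0 : 0 < p) (hp1 : p < 1 / 2) (n k : ℕ) (hkn : k ≤ n)
    (hk : (k : ℝ) ≤ p * n) :
    (2 : ℝ) ^ (-(binEntropy p * n)) ≤ p ^ k * (1 - p) ^ (n - k) := by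
  have hq : 0 < 1 - p := by linarith
  have hp : (p : ℝ) = 2 ^ (Real.logb 2 p) := (Real.rpow_logb (by norm_num) (by norm_num) hp0).symm
  have hq' : (1 - p : ℝ) = 2 ^ (Real.logb 2 (1 - p)) :=
    (Real.rpow_logb (by norm_num) (by norm_num) hq).symm
  have e : p ^ k * (1 - p) ^ (n - k)
      = (2 : ℝ) ^ (Real.logb 2 p * k + Real.logb 2 (1 - p) * ((n : ℝ) - k)) := by
    rw [Real.rpow_add (by norm_num), Real.rpow_mul (by norm_num), Real.rpow_mul (by norm_num),
      ← hp, ← hq', ← Nat.cast_sub hkn, Real.rpow_natCast, Real.rpow_natCast]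
  rw [e]
  apply Real.rpow_le_rpow_of_exponent_le (by norm_num)
  have hle : Real.logb 2 p ≤ Real.logb 2 (1 - p) :=
    Real.logb_le_logb_of_le (by norm_num) hp0 (by linarith)
  unfold binEntropy
  nlinarith [mul_nonneg (sub_nonneg.2 hle) (sub_nonneg.2 hk)]

/-- Weak Turán bound. -/
lemma exists_indep {α : Type*} [Fintype α] (r : α → α → Prop)
    (hrefl : ∀ x, r x x) (hsymm : ∀ x y, r x y → r y x) (D : ℝ) (hD : 0 < D)
    (g : α → α → ℝ) (hg0 : ∀ x y, 0 ≤ g x y) (hg : ∀ x y, r x y → 1 ≤ g x y)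
    (hsum : ∑ x, ∑ y, g x y ≤ Fintype.card α * D) :
    ∃ C : Finset α, (Fintype.card α : ℝ) ≤ 4 * D * C.card ∧
      ∀ x ∈ C, ∀ y ∈ C, x ≠ y → ¬ r x y := by
  classical
  set A : Finset α := Finset.univ.filter fun x => ∑ y, g x y ≤ 2 * D with hA
  have hAc : (Aᶜ.card : ℝ) * (2 * D) ≤ Fintype.card α * D := by
    refine le_trans ?_ hsum
    calc (Aᶜ.card : ℝ) * (2 * D) = ∑ x ∈ Aᶜ, 2 * D := by simp
      _ ≤ ∑ x ∈ Aᶜ, ∑ y, g x y := by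
        apply Finset.sum_le_sum
        intro x hx
        simp [hA] at hx
        exact hx.le
      _ ≤ ∑ x, ∑ y, g x y :=
        Finset.sum_le_sum_of_subset_of_nonneg (Finset.subset_univ _)
          fun x _ _ => Finset.sum_nonneg fun y _ => hg0 x y
  have hcard : (A.card : ℝ) + Aᶜ.card = Fintype.card α := by
    exact_mod_cast Finset.card_add_card_compl A
  have hAbig : (Fintype.card α : ℝ) ≤ 2 * A.card := by
    have : (Aᶜ.card : ℝ) * 2 ≤ Fintype.card α := by
      apply le_of_mul_le_mul_right _ hD
      linarith
    linarith
  obtain ⟨C, hC, hmax⟩ := Finset.exists_max_image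
    (A.powerset.filter fun C => ∀ x ∈ C, ∀ y ∈ C, x ≠ y → ¬ r x y) Finset.card
    ⟨∅, by simp⟩
  rw [Finset.mem_filter, Finset.mem_powerset] at hC
  refine ⟨C, ?_, hC.2⟩
  have hcov : A ⊆ C.biUnion fun x => Finset.univ.filter fun y => r x y := by
    intro a ha
    by_contra hn
    simp only [Finset.mem_biUnion, Finset.mem_filter, Finset.mem_univ, true_and, not_exists,
      not_and] at hn
    have haC : a ∉ C := fun h => hn a h (hrefl a)
    have := hmax (insert a C) (by
      rw [Finset.mem_filter, Finset.mem_powerset]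
      refine ⟨Finset.insert_subset ha hC.1, ?_⟩
      intro x hx y hy hxy
      rw [Finset.mem_insert] at hx hy
      rcases hx with rfl | hx <;> rcases hy with rfl | hy
      · exact absurd rfl hxy
      · exact fun h => hn y hy (hsymm _ _ h)
      · exact hn x hx
      · exact hC.2 x hx y hy hxy)
    rw [Finset.card_insert_of_notMem haC] at this
    omega
  have h1 : (A.card : ℝ) ≤ ∑ x ∈ C, ((Finset.univ.filter fun y => r x y).card : ℝ) := by
    exact_mod_cast (Finset.card_le_card hcov).trans Finset.card_biUnion_le
  have h2 : ∑ x ∈ C, ((Finset.univ.filter fun y => r x y).card : ℝ) ≤ ∑ x ∈ C, 2 * D := by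
    apply Finset.sum_le_sum
    intro x hx
    have hxA := hC.1 hx
    rw [hA, Finset.mem_filter] at hxA
    refine le_trans ?_ hxA.2
    calc ((Finset.univ.filter fun y => r x y).card : ℝ)
        = ∑ y ∈ Finset.univ.filter (fun y => r x y), (1 : ℝ) := by simp
      _ ≤ ∑ y ∈ Finset.univ.filter (fun y => r x y), g x y :=
        Finset.sum_le_sum fun y hy => hg x y (Finset.mem_filter.1 hy).2
      _ ≤ ∑ y, g x y :=
        Finset.sum_le_sum_of_subset_of_nonneg (Finset.subset_univ _) fun y _ _ => hg0 x y
  rw [Finset.sum_const, nsmul_eq_mul] at h2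
  linarith

/-- If p ∈ (0, 1/2) satisfies 1 - 2H(p) + p > 0, then there are c > 0
and N such that for all n ≥ N there is a set C of binary strings of length n with
|C| ≥ 2^{c·n} and no two distinct strings of C have a common subsequence of length
at least n - ⌊p·n⌋. -/
theorem stmt_4 (p : ℝ) (hp0 : 0 < p) (hp1 : p < 1 / 2)
    (h : 1 - 2 * binEntropy p + p > 0) :
    ∃ c : ℝ, 0 < c ∧ ∃ N : ℕ, ∀ n : ℕ, N ≤ n →
      ∃ C : Finset (Fin n → Bool),
        (2 : ℝ) ^ (c * n) ≤ (C.card : ℝ) ∧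
        ∀ x ∈ C, ∀ y ∈ C, x ≠ y →
          ¬ ∃ z : List Bool, z.Sublist (List.ofFn x) ∧ z.Sublist (List.ofFn y) ∧
              n - ⌊p * n⌋₊ ≤ z.length := by
  set δ := 1 - 2 * binEntropy p + p with hδ
  refine ⟨δ / 2, by linarith, ⌈6 / δ⌉₊, ?_⟩
  intro n hn
  have hn' : 6 ≤ δ * n := by
    have := (Nat.ceil_le.1 hn)
    rw [div_le_iff₀ h] at this
    linarith
  set k := ⌊p * n⌋₊ with hkdef
  have hpn : 0 ≤ p * n := by positivity
  have hk : (k : ℝ) ≤ p * n := Nat.floor_le hpn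
  have hk2 : p * n < k + 1 := Nat.lt_floor_add_one _
  have hkn : k ≤ n := by
    have : (k : ℝ) ≤ n := hk.trans (by nlinarith [(Nat.cast_nonneg n : (0 : ℝ) ≤ n)])
    exact_mod_cast this
  set B : ℝ := (2 : ℝ) ^ (binEntropy p * n) with hB
  have hBpos : 0 < B := by positivity
  have hcount : ∀ z : Fin (n - k) → Bool, superCount n (List.ofFn z) ≤ B := by
    intro z
    have h1 := superCount_le p hp0 hp1 n (List.ofFn z)
    rw [List.length_ofFn, Nat.sub_sub_self hkn] at h1
    have h2 := entropy_bound p hp0 hp1 n k hkn hk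
    have h3 := (mul_le_mul_of_nonneg_left h2 (superCount_nonneg n (List.ofFn z))).trans h1
    rw [Real.rpow_neg (by norm_num), ← hB, ← div_eq_mul_inv, div_le_one hBpos] at h3
    exact h3
  obtain ⟨C, hC1, hC2⟩ := exists_indep
    (fun x y : Fin n → Bool => ∃ z : List Bool, z.Sublist (List.ofFn x) ∧
      z.Sublist (List.ofFn y) ∧ n - k ≤ z.length)
    (fun x => ⟨List.ofFn x, List.Sublist.refl _, List.Sublist.refl _, by simp⟩)
    (fun x y ⟨z, h1, h2, h3⟩ => ⟨z, h2, h1, h3⟩)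
    ((2 : ℝ) ^ (1 - p * n) * B ^ 2) (by positivity)
    (fun x y => ∑ z : Fin (n - k) → Bool, subInd (List.ofFn z) x * subInd (List.ofFn z) y)
    (fun x y => Finset.sum_nonneg fun z _ => mul_nonneg (subInd_nonneg _ _) (subInd_nonneg _ _))
    (by
      rintro x y ⟨z, hzx, hzy, hz⟩
      have hlen : (z.take (n - k)).length = n - k := by simp [hz]
      obtain ⟨w, hw⟩ : ∃ w : Fin (n - k) → Bool, List.ofFn w = z.take (n - k) := by
        refine ⟨fun i => (z.take (n - k)).get (i.cast hlen.symm), ?_⟩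
        apply List.ext_get
        · simp [hz]
        · intro i h1 h2
          simp
      have e : subInd (List.ofFn w) x * subInd (List.ofFn w) y = 1 := by
        unfold subInd
        rw [hw, if_pos ((List.take_sublist _ _).trans hzx),
          if_pos ((List.take_sublist _ _).trans hzy), one_mul]
      rw [← e]
      exact Finset.single_le_sum
        (f := fun z : Fin (n - k) → Bool => subInd (List.ofFn z) x * subInd (List.ofFn z) y)
        (fun z _ => mul_nonneg (subInd_nonneg _ _) (subInd_nonneg _ _)) (Finset.mem_univ w))
    (by
      have e : ∑ x : Fin n → Bool, ∑ y : Fin n → Bool, ∑ z : Fin (n - k) → Bool,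
          subInd (List.ofFn z) x * subInd (List.ofFn z) y
          = ∑ z : Fin (n - k) → Bool, superCount n (List.ofFn z) ^ 2 := by
        have : ∀ z : Fin (n - k) → Bool, superCount n (List.ofFn z) ^ 2
            = ∑ x : Fin n → Bool, ∑ y : Fin n → Bool,
              subInd (List.ofFn z) x * subInd (List.ofFn z) y := by
          intro z
          rw [sq, superCount, Finset.sum_mul_sum]
        rw [Finset.sum_congr rfl fun z _ => this z, Finset.sum_comm]
        refine Eq.trans ?_ Finset.sum_comm
        rw [Finset.sum_comm]
        exact Finset.sum_congr rfl fun x _ => Finset.sum_comm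
      rw [e]
      calc ∑ z : Fin (n - k) → Bool, superCount n (List.ofFn z) ^ 2
          ≤ ∑ z : Fin (n - k) → Bool, B ^ 2 := by
            apply Finset.sum_le_sum
            intro z _
            exact pow_le_pow_left₀ (superCount_nonneg _ _) (hcount z) 2
        _ = (2 : ℝ) ^ ((n : ℝ) - k) * B ^ 2 := by
            rw [← Nat.cast_sub hkn, Real.rpow_natCast]
            simp
        _ ≤ (2 : ℝ) ^ ((n : ℝ) + (1 - p * n)) * B ^ 2 := by
            apply mul_le_mul_of_nonneg_right _ (by positivity)
            apply Real.rpow_le_rpow_of_exponent_le (by norm_num)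
            linarith
        _ = _ := by
            rw [Real.rpow_add (by norm_num), Real.rpow_natCast]
            simp [mul_assoc])
  refine ⟨C, ?_, hC2⟩
  have e4 : 4 * ((2 : ℝ) ^ (1 - p * n) * B ^ 2)
      = (2 : ℝ) ^ (2 + (1 - p * n) + 2 * (binEntropy p * n)) := by
    rw [Real.rpow_add (by norm_num), Real.rpow_add (by norm_num), hB,
      two_mul (binEntropy p * n), Real.rpow_add (by norm_num)]
    norm_num
    ring
  have e5 : (Fintype.card (Fin n → Bool) : ℝ) = (2 : ℝ) ^ (n : ℝ) := by
    rw [Real.rpow_natCast]; simp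
  rw [e4, e5] at hC1
  have hpos : (0 : ℝ) < (2 : ℝ) ^ (2 + (1 - p * n) + 2 * (binEntropy p * n)) := by positivity
  refine le_of_mul_le_mul_left (le_trans ?_ hC1) hpos
  rw [← Real.rpow_add (by norm_num)]
  apply Real.rpow_le_rpow_of_exponent_le (by norm_num)
  have : δ * n = n - 2 * (binEntropy p * n) + p * n := by rw [hδ]; ring
  linarith
end

section
/- Let γ ∈ [0,1] be the constant such that L_n/n → γ as n → ∞, where L_n is the expected length of the longest common subsequence of two independent uniformly random binary strings of length n. Then for every p with 0 < p < 1 - γ, there exist a constant c > 0 and an integer N such that for all n ≥ N there is a set C of binary strings of length n with |C| ≥ 2^{c·n} and with the property that any two distinct strings of C have longest common subsequence of length strictly less than (1-p)·n. (Hence the zero-error capacity of the adversarial deletion channel that deletes up to p·n of n transmitted bits is positive whenever p < 1 - γ.) -/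
/-- The length of the longest common subsequence of two lists. -/
noncomputable def lcsLen (x y : List Bool) : ℕ :=
  sSup {m : ℕ | ∃ z : List Bool, z.Sublist x ∧ z.Sublist y ∧ z.length = m}

/-- `expLCS n` is the expected length of the longest common subsequence of two
independent uniformly random binary strings of length n. -/
noncomputable def expLCS (n : ℕ) : ℝ :=
  (∑ x : Fin n → Bool, ∑ y : Fin n → Bool,
    (lcsLen (List.ofFn x) (List.ofFn y) : ℝ)) / 4 ^ n

theorem lcs_bddAbove (x y : List Bool) :
    BddAbove {m : ℕ | ∃ z : List Bool, z.Sublist x ∧ z.Sublist y ∧ z.length = m} := by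
  refine ⟨x.length, ?_⟩
  rintro m ⟨z, hx, _, rfl⟩
  exact hx.length_le

theorem le_lcsLen {x y z : List Bool} (hx : z.Sublist x) (hy : z.Sublist y) :
    z.length ≤ lcsLen x y :=
  le_csSup (lcs_bddAbove x y) ⟨z, hx, hy, rfl⟩

theorem exists_lcs (x y : List Bool) :
    ∃ z : List Bool, z.Sublist x ∧ z.Sublist y ∧ z.length = lcsLen x y :=
  Nat.sSup_mem (s := {m : ℕ | ∃ z : List Bool, z.Sublist x ∧ z.Sublist y ∧ z.length = m})
    ⟨0, [], by simp, by simp, rfl⟩ (lcs_bddAbove x y)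

theorem lcsLen_comm (x y : List Bool) : lcsLen x y = lcsLen y x := by
  unfold lcsLen
  congr 1
  ext m
  constructor
  · rintro ⟨z, h1, h2, h3⟩
    exact ⟨z, h2, h1, h3⟩
  · rintro ⟨z, h1, h2, h3⟩
    exact ⟨z, h2, h1, h3⟩

theorem sublist_set_aux (b : Bool) (l : List Bool) :
    ∀ (i : ℕ) (z : List Bool), z.Sublist l →
      ∃ z' : List Bool, z'.Sublist z ∧ z'.Sublist (l.set i b) ∧ z.length ≤ z'.length + 1 := by
  induction l with
  | nil =>
    intro i z hz
    exact ⟨z, List.Sublist.refl z, by simpa using hz, by omega⟩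
  | cons a l ih =>
    intro i z hz
    cases i with
    | zero =>
      rw [List.set_cons_zero]
      cases hz with
      | cons _ h => exact ⟨z, List.Sublist.refl z, h.cons _, by omega⟩
      | cons_cons _ h =>
        rename_i w
        exact ⟨w, List.sublist_cons_self _ _, h.cons _, by simp⟩
    | succ i =>
      rw [List.set_cons_succ]
      cases hz with
      | cons _ h =>
        obtain ⟨z', h1, h2, h3⟩ := ih i z h
        exact ⟨z', h1, h2.cons _, h3⟩
      | cons_cons _ h =>
        rename_i w
        obtain ⟨z', h1, h2, h3⟩ := ih i w h
        exact ⟨a :: z', h1.cons_cons _, h2.cons_cons _, by simpa using h3⟩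

theorem lcsLen_le_set (x y : List Bool) (i : ℕ) (b : Bool) :
    lcsLen x y ≤ lcsLen (x.set i b) y + 1 := by
  obtain ⟨z, h1, h2, h3⟩ := exists_lcs x y
  obtain ⟨z', h4, h5, h6⟩ := sublist_set_aux b x i z h1
  have := le_lcsLen h5 (h4.trans h2)
  omega

theorem ofFn_update_eq_set {n : ℕ} (x : Fin n → Bool) (i : Fin n) (b : Bool) :
    List.ofFn (Function.update x i b) = (List.ofFn x).set i b := by
  apply List.ext_getElem
  · simp
  · intro k h1 h2
    simp only [List.getElem_ofFn, List.getElem_set, Function.update_apply, Fin.ext_iff]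
    simp only [eq_comm]

/-- Bounded differences with constant one. -/
def BddDiff {n : ℕ} (f : (Fin n → Bool) → ℝ) : Prop :=
  ∀ x i b, |f (Function.update x i b) - f x| ≤ 1

theorem bddDiff_lcs {n : ℕ} (y : List Bool) :
    BddDiff (fun x : Fin n → Bool => (lcsLen (List.ofFn x) y : ℝ)) := by
  have key : ∀ (x : Fin n → Bool) i b,
      (lcsLen (List.ofFn x) y : ℝ) ≤ lcsLen (List.ofFn (Function.update x i b)) y + 1 := by
    intro x i b
    rw [ofFn_update_eq_set]
    exact_mod_cast lcsLen_le_set _ _ _ _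
  intro x i b
  have h1 := key x i b
  have h2 := key (Function.update x i b) i (x i)
  simp only [Function.update_idem, Function.update_eq_self] at h2
  rw [abs_le]
  constructor <;> linarith

theorem sum_cons {n : ℕ} (g : (Fin (n + 1) → Bool) → ℝ) :
    ∑ x, g x = ∑ x : Fin n → Bool, (g (Fin.cons true x) + g (Fin.cons false x)) := by
  rw [← (Fin.consEquiv (fun _ : Fin (n + 1) => Bool)).sum_comp, Fintype.sum_prod_type_right]
  simp [Fin.consEquiv]

theorem two_point (t u v : ℝ) (h : |u - v| ≤ 1) :
    Real.exp (t * u) + Real.exp (t * v)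
      ≤ 2 * (Real.exp (t * ((u + v) / 2)) * Real.exp (t ^ 2 / 8)) := by
  have h1 := Real.cosh_le_exp_half_sq (t * ((u - v) / 2))
  have h2 : Real.exp (t * u) + Real.exp (t * v)
      = 2 * (Real.exp (t * ((u + v) / 2)) * Real.cosh (t * ((u - v) / 2))) := by
    rw [Real.cosh_eq]
    have e1 : t * u = t * ((u + v) / 2) + t * ((u - v) / 2) := by ring
    have e2 : t * v = t * ((u + v) / 2) + -(t * ((u - v) / 2)) := by ring
    rw [e1, e2, Real.exp_add, Real.exp_add]
    ring
  rw [h2]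
  have h3 : (t * ((u - v) / 2)) ^ 2 / 2 ≤ t ^ 2 / 8 := by
    have : (u - v) ^ 2 ≤ 1 := by
      rw [← sq_abs]
      exact pow_le_one₀ (abs_nonneg _) h
    nlinarith [sq_nonneg t]
  have h4 := Real.exp_le_exp.2 h3
  gcongr
  exact h1.trans h4

theorem mgf_bound (t : ℝ) : ∀ (n : ℕ) (f : (Fin n → Bool) → ℝ), BddDiff f →
    ∑ x, Real.exp (t * f x)
      ≤ 2 ^ n * (Real.exp (t * ((∑ x, f x) / 2 ^ n)) * Real.exp (t ^ 2 / 8 * n)) := by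
  intro n
  induction n with
  | zero =>
    intro f _
    simp
  | succ n ih =>
    intro f hf
    have hg : BddDiff (fun x : Fin n → Bool => (f (Fin.cons true x) + f (Fin.cons false x)) / 2) := by
      intro x i b
      have h1 := hf (Fin.cons true x) i.succ b
      have h2 := hf (Fin.cons false x) i.succ b
      rw [← Fin.cons_update] at h1 h2
      rw [abs_le] at *
      constructor <;> linarith [h1.1, h1.2, h2.1, h2.2]
    have h := ih _ hg
    rw [sum_cons (fun x => Real.exp (t * f x)), sum_cons f]
    have hs : ∑ x : Fin n → Bool, (Real.exp (t * f (Fin.cons true x)) + Real.exp (t * f (Fin.cons false x)))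
        ≤ ∑ x : Fin n → Bool, 2 * (Real.exp (t * ((f (Fin.cons true x) + f (Fin.cons false x)) / 2))
            * Real.exp (t ^ 2 / 8)) := by
      apply Finset.sum_le_sum
      intro x _
      apply two_point
      have := hf (Fin.cons false x) 0 true
      rwa [Fin.update_cons_zero] at this
    refine hs.trans ?_
    rw [← Finset.mul_sum, ← Finset.sum_mul]
    calc _ ≤ 2 * ((2 ^ n * (Real.exp (t * ((∑ x : Fin n → Bool, (f (Fin.cons true x) + f (Fin.cons false x)) / 2) / 2 ^ n)) * Real.exp (t ^ 2 / 8 * n))) * Real.exp (t ^ 2 / 8)) := by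
          gcongr
      _ = _ := by
          rw [← Finset.sum_div, div_div, ← pow_succ']
          have : t ^ 2 / 8 * ((n + 1 : ℕ) : ℝ) = t ^ 2 / 8 * n + t ^ 2 / 8 := by
            push_cast; ring
          rw [this, Real.exp_add]
          ring

theorem mgf_lcs (t : ℝ) (n : ℕ) :
    ∑ x : Fin n → Bool, ∑ y : Fin n → Bool, Real.exp (t * lcsLen (List.ofFn x) (List.ofFn y))
      ≤ 4 ^ n * Real.exp (t * expLCS n + t ^ 2 / 4 * n) := by
  set F : (Fin n → Bool) → (Fin n → Bool) → ℝ :=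
    fun x y => (lcsLen (List.ofFn x) (List.ofFn y) : ℝ) with hF
  have hG : BddDiff (fun x => (∑ y, F x y) / 2 ^ n) := by
    intro x i b
    rw [← sub_div, ← Finset.sum_sub_distrib, abs_div, abs_of_pos (by positivity : (0 : ℝ) < 2 ^ n),
      div_le_one (by positivity)]
    refine (Finset.abs_sum_le_sum_abs _ _).trans ?_
    refine (Finset.sum_le_sum (fun y _ => bddDiff_lcs (List.ofFn y) x i b)).trans ?_
    simp
  have h1 : ∀ x, ∑ y, Real.exp (t * F x y)
      ≤ 2 ^ n * (Real.exp (t * ((∑ y, F x y) / 2 ^ n)) * Real.exp (t ^ 2 / 8 * n)) := by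
    intro x
    apply mgf_bound
    intro y i b
    have := bddDiff_lcs (List.ofFn x) y i b
    simp only [hF]
    rw [lcsLen_comm, lcsLen_comm (List.ofFn x) (List.ofFn y)]
    exact this
  have h2 := mgf_bound t n _ hG
  calc _ ≤ ∑ x, 2 ^ n * (Real.exp (t * ((∑ y, F x y) / 2 ^ n)) * Real.exp (t ^ 2 / 8 * n)) :=
        Finset.sum_le_sum (fun x _ => h1 x)
    _ = 2 ^ n * ((∑ x, Real.exp (t * ((∑ y, F x y) / 2 ^ n))) * Real.exp (t ^ 2 / 8 * n)) := by
        rw [← Finset.mul_sum, ← Finset.sum_mul]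
    _ ≤ 2 ^ n * ((2 ^ n * (Real.exp (t * ((∑ x, (∑ y, F x y) / 2 ^ n) / 2 ^ n))
          * Real.exp (t ^ 2 / 8 * n))) * Real.exp (t ^ 2 / 8 * n)) := by
        gcongr
    _ = _ := by
        have e : (∑ x, (∑ y, F x y) / 2 ^ n) / 2 ^ n = expLCS n := by
          rw [← Finset.sum_div, div_div, ← mul_pow]
          norm_num [expLCS, hF]
        rw [e]
        have e2 : t * expLCS n + t ^ 2 / 4 * n = t * expLCS n + t ^ 2 / 8 * n + t ^ 2 / 8 * n := by ring
        rw [e2, Real.exp_add, Real.exp_add]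
        have e3 : (4 : ℝ) ^ n = 2 ^ n * 2 ^ n := by rw [← mul_pow]; norm_num
        rw [e3]
        ring

open Classical in
theorem tail_lcs (a ε : ℝ) (hε : 0 < ε) (n : ℕ) (hE : expLCS n ≤ (a - ε) * n) :
    ∑ x : Fin n → Bool, (((Finset.univ.filter
      (fun y : Fin n → Bool => a * n ≤ (lcsLen (List.ofFn x) (List.ofFn y) : ℝ))).card : ℕ) : ℝ)
      ≤ 4 ^ n * Real.exp (-(ε ^ 2 * n)) := by
  have h := mgf_lcs (2 * ε) n
  have h1 : (∑ x : Fin n → Bool, (((Finset.univ.filter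
      (fun y : Fin n → Bool => a * n ≤ (lcsLen (List.ofFn x) (List.ofFn y) : ℝ))).card : ℕ) : ℝ))
      * Real.exp (2 * ε * (a * n)) ≤
      ∑ x : Fin n → Bool, ∑ y : Fin n → Bool,
        Real.exp (2 * ε * lcsLen (List.ofFn x) (List.ofFn y)) := by
    rw [Finset.sum_mul]
    apply Finset.sum_le_sum
    intro x _
    rw [Finset.card_filter]
    push_cast
    rw [Finset.sum_mul]
    apply Finset.sum_le_sum
    intro y _
    split_ifs with hc
    · rw [one_mul]
      apply Real.exp_le_exp.2
      gcongr
    · rw [zero_mul]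
      positivity
  have h2 := h1.trans h
  rw [← le_div_iff₀ (Real.exp_pos _), mul_div_assoc, ← Real.exp_sub] at h2
  refine h2.trans ?_
  gcongr
  nlinarith

open Classical in
theorem indep_set {V : Type*} [Fintype V] [Nonempty V] (R : V → V → Prop) (hrefl : ∀ x, R x x)
    (hsymm : ∀ x y, R x y → R y x) (q : ℝ) (hq : 0 < q)
    (hR : ∑ x : V, (((Finset.univ.filter (fun y => R x y)).card : ℕ) : ℝ)
      ≤ (Fintype.card V : ℝ) ^ 2 * q) :
    ∃ C : Finset V, 1 / (4 * q) ≤ (C.card : ℝ) ∧ ∀ x ∈ C, ∀ y ∈ C, x ≠ y → ¬ R x y := by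
  set M : ℝ := (Fintype.card V : ℝ) with hM
  have hMpos : 0 < M := by rw [hM]; exact_mod_cast Fintype.card_pos
  set N : V → Finset V := fun x => Finset.univ.filter (fun y => R x y) with hN
  set W : Finset V := Finset.univ.filter (fun x => ((N x).card : ℝ) ≤ 2 * M * q) with hW
  have hWc : M / 2 ≤ (W.card : ℝ) := by
    have h1 : ((Wᶜ).card : ℝ) * (2 * M * q) ≤ M ^ 2 * q := by
      refine le_trans ?_ hR
      calc ((Wᶜ).card : ℝ) * (2 * M * q) = ∑ x ∈ Wᶜ, (2 * M * q) := by simp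
        _ ≤ ∑ x ∈ Wᶜ, ((N x).card : ℝ) := by
            apply Finset.sum_le_sum
            intro x hx
            simp only [hW, Finset.mem_compl, Finset.mem_filter, Finset.mem_univ, true_and,
              not_le] at hx
            exact hx.le
        _ ≤ _ := Finset.sum_le_sum_of_subset_of_nonneg (Finset.subset_univ _)
            (fun _ _ _ => by positivity)
    have h2 : ((Wᶜ).card : ℝ) = M - W.card := by
      have := Finset.card_compl_add_card W
      rw [hM, ← this]; push_cast; ring
    rw [h2] at h1
    have h3 : (M * q) * (2 * (M - W.card)) ≤ (M * q) * M := by nlinarith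
    have := le_of_mul_le_mul_left h3 (by positivity)
    linarith
  set S : Finset (Finset V) :=
    W.powerset.filter (fun C => ∀ x ∈ C, ∀ y ∈ C, x ≠ y → ¬ R x y) with hS
  obtain ⟨C, hC, hmax⟩ := Finset.exists_max_image S Finset.card ⟨∅, by simp [hS]⟩
  simp only [hS, Finset.mem_filter, Finset.mem_powerset] at hC hmax
  refine ⟨C, ?_, hC.2⟩
  have hcov : W ⊆ C.biUnion N := by
    intro w hw
    by_contra hcon
    simp only [hN, Finset.mem_biUnion, Finset.mem_filter, Finset.mem_univ, true_and, not_exists,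
      not_and] at hcon
    have hwC : w ∉ C := fun h => hcon w h (hrefl w)
    have := hmax (insert w C) ⟨Finset.insert_subset hw hC.1, by
      intro x hx y hy hxy
      rw [Finset.mem_insert] at hx hy
      rcases hx with rfl | hx <;> rcases hy with rfl | hy
      · exact absurd rfl hxy
      · exact fun h => hcon y hy (hsymm _ _ h)
      · exact hcon x hx
      · exact hC.2 x hx y hy hxy⟩
    rw [Finset.card_insert_of_notMem hwC] at this
    omega
  have h4 : (W.card : ℝ) ≤ C.card * (2 * M * q) := by
    calc (W.card : ℝ) ≤ ((C.biUnion N).card : ℝ) := by exact_mod_cast Finset.card_le_card hcov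
      _ ≤ ∑ x ∈ C, ((N x).card : ℝ) := by exact_mod_cast Finset.card_biUnion_le
      _ ≤ ∑ x ∈ C, (2 * M * q) := by
          apply Finset.sum_le_sum
          intro x hx
          have := hC.1 hx
          simp only [hW, Finset.mem_filter, Finset.mem_univ, true_and] at this
          exact this
      _ = _ := by simp
  rw [div_le_iff₀ (by positivity)]
  have h5 : M * 1 ≤ M * (C.card * (4 * q)) := by nlinarith
  exact le_of_mul_le_mul_left h5 hMpos

theorem stmt_11 (γ : ℝ) (hγ : γ ∈ Set.Icc (0 : ℝ) 1)
    (hlim : Filter.Tendsto (fun n : ℕ => expLCS n / n) Filter.atTop (nhds γ))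
    (p : ℝ) (hp0 : 0 < p) (hp1 : p < 1 - γ) :
    ∃ c : ℝ, 0 < c ∧ ∃ N : ℕ, ∀ n : ℕ, N ≤ n →
      ∃ C : Finset (Fin n → Bool),
        (2 : ℝ) ^ (c * n) ≤ (C.card : ℝ) ∧
        ∀ x ∈ C, ∀ y ∈ C, x ≠ y →
          (lcsLen (List.ofFn x) (List.ofFn y) : ℝ) < (1 - p) * n := by
  obtain ⟨ε, hε⟩ : ∃ ε, ε = (1 - p - γ) / 2 := ⟨_, rfl⟩
  have hεpos : 0 < ε := by rw [hε]; linarith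
  have hev := hlim.eventually (gt_mem_nhds (show γ < (1 - p) - ε by rw [hε]; linarith))
  obtain ⟨N₀, hN₀⟩ := Filter.eventually_atTop.1 hev
  obtain ⟨N₁, hN₁⟩ := exists_nat_ge (6 / ε ^ 2)
  refine ⟨ε ^ 2 / 2, by positivity, max (max N₀ N₁) 1, ?_⟩
  intro n hn
  have hn0 : N₀ ≤ n := by omega
  have hn1 : N₁ ≤ n := by omega
  have hn2 : 1 ≤ n := by omega
  have hnpos : (0 : ℝ) < n := by exact_mod_cast hn2
  have hE : expLCS n ≤ ((1 - p) - ε) * n := by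
    have := hN₀ n hn0
    rw [div_lt_iff₀ hnpos] at this
    exact this.le
  have htail := tail_lcs (1 - p) ε hεpos n hE
  obtain ⟨C, hC1, hC2⟩ := indep_set
    (fun x y : Fin n → Bool => (1 - p) * n ≤ (lcsLen (List.ofFn x) (List.ofFn y) : ℝ))
    (by
      intro x
      have h := le_lcsLen (List.Sublist.refl (List.ofFn x)) (List.Sublist.refl (List.ofFn x))
      rw [List.length_ofFn] at h
      have h' : (n : ℝ) ≤ lcsLen (List.ofFn x) (List.ofFn x) := by exact_mod_cast h
      nlinarith)
    (by
      intro x y h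
      rwa [lcsLen_comm])
    (Real.exp (-(ε ^ 2 * n))) (Real.exp_pos _)
    (by
      refine htail.trans (le_of_eq ?_)
      congr 1
      simp only [Fintype.card_pi, Fintype.card_bool, Finset.prod_const, Finset.card_univ,
        Fintype.card_fin]
      push_cast
      rw [← pow_mul, mul_comm n 2, pow_mul]
      norm_num)
  refine ⟨C, le_trans ?_ hC1, fun x hx y hy hxy => not_le.1 (hC2 x hx y hy hxy)⟩
  have h6 : 6 ≤ ε ^ 2 * n := by
    have : 6 / ε ^ 2 ≤ (n : ℝ) := hN₁.trans (by exact_mod_cast hn1)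
    rw [div_le_iff₀ (by positivity)] at this
    linarith
  rw [Real.exp_neg, le_div_iff₀ (by positivity)]
  have hA : (2 : ℝ) ^ (ε ^ 2 / 2 * n) ≤ Real.exp (ε ^ 2 * n / 2) := by
    rw [Real.rpow_def_of_pos (by norm_num)]
    apply Real.exp_le_exp.2
    have := Real.log_two_lt_d9
    nlinarith
  have hB : 4 ≤ Real.exp (ε ^ 2 * n / 2) := by
    have := Real.add_one_le_exp (ε ^ 2 * n / 2)
    linarith
  have hsplit : Real.exp (ε ^ 2 * n) = Real.exp (ε ^ 2 * n / 2) * Real.exp (ε ^ 2 * n / 2) := by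
    rw [← Real.exp_add]; ring_nf
  rw [hsplit]
  have hpos := Real.exp_pos (ε ^ 2 * n / 2)
  calc (2 : ℝ) ^ (ε ^ 2 / 2 * n) * (4 * (Real.exp (ε ^ 2 * n / 2) * Real.exp (ε ^ 2 * n / 2))⁻¹)
      ≤ Real.exp (ε ^ 2 * n / 2) * (Real.exp (ε ^ 2 * n / 2)
        * (Real.exp (ε ^ 2 * n / 2) * Real.exp (ε ^ 2 * n / 2))⁻¹) := by gcongr
    _ = 1 := by field_simp
end

section
/- Let G be a finite simple graph on vertex set V, let μ : V → [0,1] be a probability distribution on V (∑_{v∈V} μ(v) = 1), and let z > 0 satisfy z·|V|·μ(v) ≤ 1 for every v ∈ V. Then G contains an independent set of size at least z·|V| − z²·|V|²·∑_{{u,v} ∈ E(G)} μ(u)·μ(v). -/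
theorem aux_expect {V : Type*} [Fintype V] [DecidableEq V] (p : V → ℝ) (T : Finset V) :
    ∑ S : Finset V, ((∏ i ∈ S, p i) * ∏ i ∈ Finset.univ \ S, (1 - p i)) *
      (if T ⊆ S then (1 : ℝ) else 0) = ∏ i ∈ T, p i := by
  have h := Finset.prod_add p (fun i => if i ∈ T then 0 else 1 - p i) Finset.univ
  have h1 : ∏ i, (p i + if i ∈ T then 0 else 1 - p i) = ∏ i ∈ T, p i := by
    rw [← Finset.prod_subset (Finset.subset_univ T)]
    · exact Finset.prod_congr rfl fun i hi => by simp [hi]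
    · intro i _ hi
      simp [hi]
  rw [← h1, h, Finset.powerset_univ]
  refine Finset.sum_congr rfl fun S _ => ?_
  rw [mul_assoc]
  congr 1
  split_ifs with hT
  · rw [mul_one]
    refine Finset.prod_congr rfl fun i hi => ?_
    have : i ∉ T := fun h => (Finset.mem_sdiff.1 hi).2 (hT h)
    simp [this]
  · obtain ⟨i, hi, hi'⟩ := Finset.not_subset.1 hT
    rw [mul_zero]
    exact (Finset.prod_eq_zero (i := i) (by simp [hi']) (by simp [hi])).symm

theorem aux_alter {V : Type*} [Fintype V] [DecidableEq V]
    (G : SimpleGraph V) [DecidableRel G.Adj] (p : V → ℝ) (h0 : ∀ v, 0 ≤ p v)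
    (h1 : ∀ v, p v ≤ 1) :
    ∃ S : Finset V, ∑ v, p v - ∑ e ∈ G.edgeFinset, ∏ i ∈ e.toFinset, p i ≤
      (S.card : ℝ) - ((G.edgeFinset.filter fun e => e.toFinset ⊆ S).card : ℝ) := by
  set W : Finset V → ℝ := fun S => (∏ i ∈ S, p i) * ∏ i ∈ Finset.univ \ S, (1 - p i) with hW
  have hE : ∀ T : Finset V, ∑ S, W S * (if T ⊆ S then (1 : ℝ) else 0) = ∏ i ∈ T, p i :=
    aux_expect p
  have hW0 : ∀ S, 0 ≤ W S := fun S => mul_nonneg (Finset.prod_nonneg fun i _ => h0 i)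
    (Finset.prod_nonneg fun i _ => sub_nonneg.2 (h1 i))
  have hW1 : ∑ S, W S = 1 := by simpa using hE ∅
  have hV : ∑ v, p v = ∑ S, W S * (S.card : ℝ) := by
    have : ∀ v, p v = ∑ S, W S * (if {v} ⊆ S then (1 : ℝ) else 0) := fun v => by
      rw [hE]; simp
    rw [Finset.sum_congr rfl fun v _ => this v, Finset.sum_comm]
    refine Finset.sum_congr rfl fun S _ => ?_
    rw [← Finset.mul_sum]
    simp
  have hG : ∑ e ∈ G.edgeFinset, ∏ i ∈ e.toFinset, p i =
      ∑ S, W S * ((G.edgeFinset.filter fun e => e.toFinset ⊆ S).card : ℝ) := by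
    rw [Finset.sum_congr rfl fun e _ => (hE e.toFinset).symm, Finset.sum_comm]
    refine Finset.sum_congr rfl fun S _ => ?_
    rw [← Finset.mul_sum, Finset.sum_boole]
  by_contra! hcon
  set c := ∑ v, p v - ∑ e ∈ G.edgeFinset, ∏ i ∈ e.toFinset, p i with hc
  have hc' : c = ∑ S, W S * ((S.card : ℝ) -
      ((G.edgeFinset.filter fun e => e.toFinset ⊆ S).card : ℝ)) := by
    simp only [mul_sub, Finset.sum_sub_distrib]
    rw [← hV, ← hG]
  have hlt : ∑ S, W S * ((S.card : ℝ) -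
      ((G.edgeFinset.filter fun e => e.toFinset ⊆ S).card : ℝ)) < ∑ S, W S * c := by
    obtain ⟨S, hS⟩ : ∃ S, 0 < W S := by
      by_contra! h
      have := Finset.sum_nonpos fun S (_ : S ∈ Finset.univ) => h S
      linarith
    exact Finset.sum_lt_sum (fun S _ => mul_le_mul_of_nonneg_left (hcon S).le (hW0 S))
      ⟨S, Finset.mem_univ _, mul_lt_mul_of_pos_left (hcon S) hS⟩
  rw [← Finset.sum_mul, hW1, one_mul, ← hc'] at hlt
  exact lt_irrefl _ hlt

/-- Probabilistic variant of Turán's theorem. If μ is a probability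
distribution on the vertices of a finite simple graph G and z > 0 satisfies
z·|V|·μ(v) ≤ 1 for every v, then G contains an independent set of size at least
z·|V| − z²·|V|²·∑_{{u,v}∈E(G)} μ(u)·μ(v). -/
theorem stmt_12 {V : Type*} [Fintype V] [DecidableEq V]
    (G : SimpleGraph V) [DecidableRel G.Adj]
    (μ : V → ℝ) (hμ0 : ∀ v, 0 ≤ μ v) (hμ1 : ∀ v, μ v ≤ 1)
    (hsum : ∑ v, μ v = 1)
    (z : ℝ) (hz : 0 < z) (hzμ : ∀ v, z * (Fintype.card V : ℝ) * μ v ≤ 1) :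
    ∃ s : Finset V, (∀ v ∈ s, ∀ w ∈ s, v ≠ w → ¬ G.Adj v w) ∧
      z * (Fintype.card V : ℝ) -
        z ^ 2 * (Fintype.card V : ℝ) ^ 2 *
          (∑ e ∈ G.edgeFinset,
            Sym2.lift ⟨fun u v => μ u * μ v, fun u v => mul_comm _ _⟩ e)
        ≤ (s.card : ℝ) := by
  obtain ⟨S, hS⟩ := aux_alter G (fun v => z * (Fintype.card V : ℝ) * μ v)
    (fun v => mul_nonneg (by positivity) (hμ0 v)) hzμ
  set E := G.edgeFinset.filter fun e => e.toFinset ⊆ S with hE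
  refine ⟨S \ E.image fun e => e.out.1, ?_, ?_⟩
  · intro v hv w hw _ hadj
    rw [Finset.mem_sdiff] at hv hw
    have he : s(v, w) ∈ E := by
      rw [hE, Finset.mem_filter]
      refine ⟨by simpa using hadj, fun x hx => ?_⟩
      rw [Sym2.mem_toFinset, Sym2.mem_iff] at hx
      rcases hx with rfl | rfl
      · exact hv.1
      · exact hw.1
    have him := Finset.mem_image_of_mem (fun e : Sym2 V => e.out.1) he
    rcases Sym2.mem_iff.1 (Sym2.out_fst_mem s(v, w)) with h | h
    · exact hv.2 (by simpa only [h] using him)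
    · exact hw.2 (by simpa only [h] using him)
  · have hcard : (S.card : ℝ) - (E.card : ℝ) ≤
        ((S \ E.image fun e => e.out.1).card : ℝ) := by
      have h1 := Finset.le_card_sdiff (E.image fun e => e.out.1) S
      have h2 : (E.image fun e => e.out.1).card ≤ E.card := Finset.card_image_le
      have h3 : S.card ≤ (S \ E.image fun e => e.out.1).card + E.card := by omega
      have : (S.card : ℝ) ≤ ((S \ E.image fun e => e.out.1).card : ℝ) + E.card := by
        exact_mod_cast h3
      linarith
    refine le_trans (le_of_eq ?_) (hS.trans hcard)
    rw [← Finset.mul_sum, hsum, mul_one, Finset.mul_sum]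
    congr 1
    refine Finset.sum_congr rfl fun e he => ?_
    induction e with
    | _ u v =>
      have huv : u ≠ v := by
        have : G.Adj u v := by simpa using he
        exact this.ne
      have ht : (s(u, v)).toFinset = {u, v} := by
        ext x
        simp [Sym2.mem_toFinset]
      rw [ht, Finset.prod_pair huv, Sym2.lift_mk]
      ring
end
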